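/- Fix b ∈ (0,3) and let u be a global classical H² solution with nonnegative momentum of the b-family equation. Set λ(t) = t^{1/2}/log t and 𝓔(t) = ∫_ℝ sech²(x/λ(t)) m(t,x) dx. Then the limit lim_{t→∞} 𝓔(t) exists, and it equals lim_{t→∞} ∫_ℝ sech²(x/λ(t)) u(t,x) dx. -/

import Mathlib

open MeasureTheory Real Filter

/-- Convolution with the Green's function of `1 - d²/dx²` on `ℝ`. -/
noncomputable def G (f : ℝ → ℝ) (x : ℝ) : ℝ :=
  (1 / 2) * ∫ y : ℝ, Real.exp (-|x - y|) * f y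

/-- The flux of the nonlocal `b`-family equation at time `t`:
`(1/2)u² + G((b/2)u² + ((3-b)/2)(∂ₓu)²)`. -/
noncomputable def flux (b : ℝ) (u : ℝ → ℝ → ℝ) (t : ℝ) : ℝ → ℝ :=
  fun y => (1 / 2) * (u t y) ^ 2
    + G (fun z => (b / 2) * (u t z) ^ 2 + ((3 - b) / 2) * (deriv (u t) z) ^ 2) y

/-- The momentum `m = u - ∂ₓ²u`. -/
noncomputable def mom (u : ℝ → ℝ → ℝ) (t x : ℝ) : ℝ :=
  u t x - deriv (deriv (u t)) x

/-- `λ_c(t) = t^c / log t`. -/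
noncomputable def lam (c t : ℝ) : ℝ := t ^ c / Real.log t

/-- `sech² z`. -/
noncomputable def sech2 (z : ℝ) : ℝ := (1 / Real.cosh z) ^ 2

/-- A global classical `H²` solution with nonnegative momentum of the nonlocal `b`-family
equation: `C¹` in `t`, `C³` in `x`, jointly continuous partial derivatives, solving the
equation pointwise on `(0,∞) × ℝ`, with `u(t,·), ∂ₓu(t,·), ∂ₓ²u(t,·) ∈ L¹(ℝ) ∩ L²(ℝ)`,
nonnegative momentum `m(t,·) ≥ 0`, and conserved total momentum
`∫ m(t,x) dx = ∫ m(0,x) dx`. -/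
def IsH2NonnegMomentumSolution (b : ℝ) (u : ℝ → ℝ → ℝ) : Prop :=
  (∀ x : ℝ, ContDiff ℝ 1 fun t => u t x) ∧
  (∀ t : ℝ, ContDiff ℝ 3 (u t)) ∧
  Continuous (fun p : ℝ × ℝ => u p.1 p.2) ∧
  Continuous (fun p : ℝ × ℝ => deriv (fun s => u s p.2) p.1) ∧
  Continuous (fun p : ℝ × ℝ => deriv (u p.1) p.2) ∧
  Continuous (fun p : ℝ × ℝ => deriv (deriv (u p.1)) p.2) ∧
  Continuous (fun p : ℝ × ℝ => deriv (fun s => deriv (u s) p.2) p.1) ∧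
  Continuous (fun p : ℝ × ℝ => deriv (fun s => deriv (deriv (u s)) p.2) p.1) ∧
  (∀ t x : ℝ, 0 < t → deriv (fun s => u s x) t + deriv (flux b u t) x = 0) ∧
  (∀ t : ℝ, 0 ≤ t →
    Integrable (u t) ∧ Integrable (fun x => (u t x) ^ 2)
    ∧ Integrable (deriv (u t)) ∧ Integrable (fun x => (deriv (u t) x) ^ 2)
    ∧ Integrable (deriv (deriv (u t))) ∧ Integrable (fun x => (deriv (deriv (u t)) x) ^ 2)) ∧
  (∀ t x : ℝ, 0 ≤ t → 0 ≤ mom u t x) ∧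
  (∀ t : ℝ, 0 ≤ t → ∫ x : ℝ, mom u t x = ∫ x : ℝ, mom u 0 x)

/-- The energy functional `𝓔(t) = ∫ sech²(x/λ(t)) m(t,x) dx` with `λ(t) = √t/log t`. -/
noncomputable def Efun (u : ℝ → ℝ → ℝ) (t : ℝ) : ℝ :=
  ∫ x : ℝ, sech2 (x / lam (1 / 2) t) * mom u t x


lemma aux_abs_deriv_le {v v' v'' : ℝ → ℝ} (h1 : ∀ x, HasDerivAt v (v' x) x)
    (h2 : ∀ x, HasDerivAt v' (v'' x) x) (i0 : Integrable v) (i1 : Integrable v')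
    (i2 : Integrable v'') (hm : ∀ x, 0 ≤ v x - v'' x) (x : ℝ) : |v' x| ≤ v x := by
  have t0 : Tendsto v atTop (nhds 0) := tendsto_zero_of_hasDerivAt_of_integrableOn_Ioi (a := 0)
    (fun x _ => h1 x) i1.integrableOn i0.integrableOn
  have t1 : Tendsto v' atTop (nhds 0) := tendsto_zero_of_hasDerivAt_of_integrableOn_Ioi (a := 0)
    (fun x _ => h2 x) i2.integrableOn i1.integrableOn
  have b0 : Tendsto v atBot (nhds 0) := tendsto_zero_of_hasDerivAt_of_integrableOn_Iic (a := 0)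
    (fun x _ => h1 x) i1.integrableOn i0.integrableOn
  have b1 : Tendsto v' atBot (nhds 0) := tendsto_zero_of_hasDerivAt_of_integrableOn_Iic (a := 0)
    (fun x _ => h2 x) i2.integrableOn i1.integrableOn
  have A : 0 ≤ v x + v' x := by
    have hd : ∀ y, HasDerivAt (fun y => Real.exp (-y) * (v y + v' y))
        (-(Real.exp (-y) * (v y - v'' y))) y := by
      intro y
      have := ((hasDerivAt_neg y).exp).mul ((h1 y).add (h2 y))
      refine this.congr_deriv ?_
      simp only [Pi.add_apply]; ring
    have anti : Antitone (fun y => Real.exp (-y) * (v y + v' y)) :=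
      antitone_of_hasDerivAt_nonpos hd
        (fun y => by have := mul_nonneg (Real.exp_pos (-y)).le (hm y); simpa using this)
    have lim : Tendsto (fun y => Real.exp (-y) * (v y + v' y)) atTop (nhds 0) := by
      have := (Real.tendsto_exp_neg_atTop_nhds_zero).mul (t0.add t1)
      simpa using this
    have : 0 ≤ Real.exp (-x) * (v x + v' x) := anti.le_of_tendsto lim x
    exact nonneg_of_mul_nonneg_right this (Real.exp_pos _)
  have B : 0 ≤ v x - v' x := by
    have hd : ∀ y, HasDerivAt (fun y => Real.exp y * (v y - v' y))
        (Real.exp y * (v y - v'' y)) y := by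
      intro y
      have := (Real.hasDerivAt_exp y).mul ((h1 y).sub (h2 y))
      refine this.congr_deriv ?_
      simp only [Pi.sub_apply]; ring
    have mono : Monotone (fun y => Real.exp y * (v y - v' y)) :=
      monotone_of_hasDerivAt_nonneg hd
        (fun y => mul_nonneg (Real.exp_pos y).le (hm y))
    have lim : Tendsto (fun y => Real.exp y * (v y - v' y)) atBot (nhds 0) := by
      have := (Real.tendsto_exp_atBot).mul (b0.sub b1)
      simpa using this
    have : 0 ≤ Real.exp x * (v x - v' x) := mono.le_of_tendsto lim x
    exact nonneg_of_mul_nonneg_right this (Real.exp_pos _)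
  rw [abs_le]; constructor <;> linarith

lemma aux_le_integral {v v' : ℝ → ℝ} (h1 : ∀ x, HasDerivAt v (v' x) x)
    (i0 : Integrable v) (i1 : Integrable v') (hb : ∀ x, |v' x| ≤ v x) (x : ℝ) :
    v x ≤ ∫ y, v y := by
  have t0 : Tendsto v atTop (nhds 0) := tendsto_zero_of_hasDerivAt_of_integrableOn_Ioi (a := 0)
    (fun x _ => h1 x) i1.integrableOn i0.integrableOn
  have e := integral_Ioi_of_hasDerivAt_of_tendsto' (a := x) (fun x _ => h1 x) i1.integrableOn t0
  calc v x = -∫ y in Set.Ioi x, v' y := by rw [e]; ring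
    _ = ∫ y in Set.Ioi x, -v' y := by rw [integral_neg]
    _ ≤ ∫ y in Set.Ioi x, v y := setIntegral_mono i1.neg.integrableOn i0.integrableOn
        (fun y => (neg_le_abs _).trans (hb y))
    _ ≤ ∫ y, v y := setIntegral_le_integral i0
        (Eventually.of_forall fun y => (abs_nonneg _).trans (hb y))

lemma aux_exp_int : Integrable (fun x : ℝ => Real.exp (-|x|)) := by
  refine (integrable_inv_one_add_sq.const_mul 2).mono' (by fun_prop) (Eventually.of_forall ?_)
  intro x
  rw [Real.norm_eq_abs, abs_of_pos (Real.exp_pos _), Real.exp_neg,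
    ← div_eq_mul_inv, inv_eq_one_div, div_le_div_iff₀ (Real.exp_pos _) (by positivity)]
  have := Real.quadratic_le_exp_of_nonneg (abs_nonneg x)
  rw [sq_abs] at this
  nlinarith [abs_nonneg x]

lemma aux_G_int {f : ℝ → ℝ} (hi : Integrable f) :
    Integrable (G f) ∧ ∫ x, G f x = (1 / 2) * ((∫ x : ℝ, Real.exp (-|x|)) * ∫ x, f x) := by
  have e : G f = fun x => (1 / 2) *
      (MeasureTheory.convolution (fun x : ℝ => Real.exp (-|x|)) f
        (ContinuousLinearMap.mul ℝ ℝ) volume) x := by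
    funext x
    rw [convolution_mul_swap]; rfl
  constructor
  · rw [e]; exact (aux_exp_int.integrable_convolution _ hi).const_mul _
  · rw [e, integral_const_mul, integral_convolution _ aux_exp_int hi]; rfl

lemma aux_G_deriv {f : ℝ → ℝ} (hc : Continuous f) (hi : Integrable f) (h0 : ∀ x, 0 ≤ f x) :
    ∃ g : ℝ → ℝ, (∀ x, HasDerivAt (G f) (g x) x) ∧ (∀ x, |g x| ≤ G f x) := by
  have I1 : ∀ x : ℝ, IntegrableOn (fun y => Real.exp y * f y) (Set.Iic x) := by
    intro x
    refine (hi.integrableOn.const_mul (Real.exp x)).mono' (by fun_prop) ?_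
    refine (ae_restrict_iff' measurableSet_Iic).2 (Eventually.of_forall fun y hy => ?_)
    rw [Real.norm_eq_abs, abs_of_nonneg (mul_nonneg (Real.exp_pos _).le (h0 y))]
    exact mul_le_mul_of_nonneg_right (Real.exp_le_exp.2 hy) (h0 y)
  have I2 : ∀ x : ℝ, IntegrableOn (fun y => Real.exp (-y) * f y) (Set.Ioi x) := by
    intro x
    refine (hi.integrableOn.const_mul (Real.exp (-x))).mono' (by fun_prop) ?_
    refine (ae_restrict_iff' measurableSet_Ioi).2 (Eventually.of_forall fun y hy => ?_)
    rw [Real.norm_eq_abs, abs_of_nonneg (mul_nonneg (Real.exp_pos _).le (h0 y))]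
    exact mul_le_mul_of_nonneg_right (Real.exp_le_exp.2 (neg_le_neg (le_of_lt hy))) (h0 y)
  set J1 : ℝ → ℝ := fun x => ∫ y in Set.Iic x, Real.exp y * f y with hJ1
  set J2 : ℝ → ℝ := fun x => ∫ y in Set.Ioi x, Real.exp (-y) * f y with hJ2
  have J1n : ∀ x, 0 ≤ J1 x := fun x => integral_nonneg fun y => mul_nonneg (Real.exp_pos _).le (h0 y)
  have J2n : ∀ x, 0 ≤ J2 x := fun x => integral_nonneg fun y => mul_nonneg (Real.exp_pos _).le (h0 y)
  have d1 : ∀ x, HasDerivAt J1 (Real.exp x * f x) x := by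
    intro x
    have e : J1 = fun x => J1 0 + ∫ y in (0:ℝ)..x, Real.exp y * f y := by
      funext z
      rw [← intervalIntegral.integral_Iic_sub_Iic (I1 0) (I1 z)]; simp [hJ1]
    rw [e]
    have := intervalIntegral.integral_hasDerivAt_right
      (f := fun y => Real.exp y * f y) (a := 0) (b := x)
      (Continuous.intervalIntegrable (by fun_prop) _ _)
      (Continuous.stronglyMeasurableAtFilter (by fun_prop) _ _)
      (Continuous.continuousAt (by fun_prop))
    exact this.const_add _
  have d2 : ∀ x, HasDerivAt J2 (-(Real.exp (-x) * f x)) x := by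
    intro x
    have e : J2 = fun x => J2 0 - ∫ y in (0:ℝ)..x, Real.exp (-y) * f y := by
      funext z
      rw [← intervalIntegral.integral_Ioi_sub_Ioi' (I2 0) (I2 z)]; simp [hJ2]
    rw [e]
    have := intervalIntegral.integral_hasDerivAt_right
      (f := fun y => Real.exp (-y) * f y) (a := 0) (b := x)
      (Continuous.intervalIntegrable (by fun_prop) _ _)
      (Continuous.stronglyMeasurableAtFilter (by fun_prop) _ _)
      (Continuous.continuousAt (by fun_prop))
    exact this.const_sub _
  have eG : ∀ x, G f x = (1 / 2) * (Real.exp (-x) * J1 x + Real.exp x * J2 x) := by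
    intro x
    have hI : Integrable (fun y => Real.exp (-|x - y|) * f y) := by
      refine hi.mono' (by fun_prop) (Eventually.of_forall fun y => ?_)
      rw [Real.norm_eq_abs, abs_of_nonneg (mul_nonneg (Real.exp_pos _).le (h0 y))]
      exact mul_le_of_le_one_left (h0 y) (Real.exp_le_one_iff.2 (by simp))
    unfold G
    rw [← intervalIntegral.integral_Iic_add_Ioi (b := x) hI.integrableOn hI.integrableOn]
    congr 2
    · rw [hJ1]; simp only
      rw [← integral_const_mul]
      refine setIntegral_congr_fun measurableSet_Iic fun y hy => ?_
      have hy : y ≤ x := hy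
      rw [abs_of_nonneg (by linarith), ← mul_assoc, ← Real.exp_add]; ring_nf
    · rw [hJ2]; simp only
      rw [← integral_const_mul]
      refine setIntegral_congr_fun measurableSet_Ioi fun y hy => ?_
      have hy : x < y := hy
      rw [abs_of_neg (by linarith), ← mul_assoc, ← Real.exp_add]; ring_nf
  refine ⟨fun x => (1 / 2) * (-(Real.exp (-x) * J1 x) + Real.exp x * J2 x), ?_, ?_⟩
  · intro x
    have e : G f = fun x => (1 / 2) * (Real.exp (-x) * J1 x + Real.exp x * J2 x) := funext eG
    rw [e]
    have := ((((hasDerivAt_neg x).exp).mul (d1 x)).add ((Real.hasDerivAt_exp x).mul (d2 x))).const_mul (1/2)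
    refine this.congr_deriv ?_
    have : Real.exp (-x) * (Real.exp x * f x) = Real.exp x * (Real.exp (-x) * f x) := by ring
    linear_combination (1/2) * this
  · intro x
    rw [eG, abs_le]
    have := mul_nonneg (Real.exp_pos (-x)).le (J1n x)
    have := mul_nonneg (Real.exp_pos x).le (J2n x)
    constructor <;> linarith

lemma aux_cosh (z : ℝ) : 1 + z ^ 2 / 4 ≤ Real.cosh z := by
  rw [← Real.cosh_abs, Real.cosh_eq]
  have := Real.quadratic_le_exp_of_nonneg (abs_nonneg z)
  have h2 := Real.add_one_le_exp (-|z|)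
  rw [sq_abs] at this
  linarith

lemma sech2_pos (z : ℝ) : 0 < sech2 z := by
  unfold sech2; have := Real.cosh_pos z; positivity

lemma sech2_le (z : ℝ) : sech2 z * (1 + z ^ 2 / 4) ^ 2 ≤ 1 := by
  unfold sech2
  rw [div_pow, one_pow, div_mul_eq_mul_div, one_mul, div_le_one (by have := Real.cosh_pos z; positivity)]
  have := aux_cosh z
  gcongr

lemma sech2_le_one (z : ℝ) : sech2 z ≤ 1 := by
  have := sech2_le z
  have h := sech2_pos z
  nlinarith [sq_nonneg z, sq_nonneg (z^2)]

lemma sech2_cont : Continuous sech2 := by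
  unfold sech2
  exact (continuous_const.div Real.continuous_cosh (fun x => (Real.cosh_pos x).ne')).pow 2

lemma abs_mul_sech2 (z : ℝ) : |z| * sech2 z ≤ 1 := by
  have := sech2_le z
  have h := sech2_pos z
  have h2 : |z| ≤ (1 + z ^ 2 / 4) ^ 2 := by
    rw [← sq_abs z]; nlinarith [sq_nonneg (|z| - 2), sq_nonneg (|z|^2), abs_nonneg z]
  nlinarith

lemma sq_mul_sech2_int : Integrable (fun z => z ^ 2 * sech2 z) := by
  refine (integrable_inv_one_add_sq.const_mul 16).mono'
    ((by fun_prop : Continuous fun z : ℝ => z ^ 2).mul sech2_cont).aestronglyMeasurable (Eventually.of_forall fun z => ?_)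
  have h := sech2_pos z
  rw [Real.norm_eq_abs, abs_of_nonneg (by positivity), ← div_eq_mul_inv, le_div_iff₀ (by positivity)]
  have := sech2_le z
  have h2 : z ^ 2 * (1 + z ^ 2) ≤ 16 * (1 + z ^ 2 / 4) ^ 2 := by nlinarith [sq_nonneg z]
  nlinarith

lemma hasDerivAt_sech2 (z : ℝ) : HasDerivAt sech2 (-2 * sech2 z * Real.tanh z) z := by
  have h := ((Real.hasDerivAt_cosh z).inv (Real.cosh_pos z).ne').pow 2
  have e : sech2 = (Real.cosh⁻¹) ^ 2 := by funext x; simp [sech2]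
  rw [e]
  refine h.congr_deriv ?_
  have := (Real.cosh_pos z).ne'
  simp [Real.tanh_eq_sinh_div_cosh]
  field_simp

lemma hasDerivAt_tanh' (z : ℝ) : HasDerivAt Real.tanh (sech2 z) z := by
  have h := (Real.hasDerivAt_sinh z).div (Real.hasDerivAt_cosh z) (Real.cosh_pos z).ne'
  have e : Real.tanh = Real.sinh / Real.cosh := by funext x; simp [Real.tanh_eq_sinh_div_cosh]
  rw [e]
  refine h.congr_deriv ?_
  have := Real.cosh_sq_sub_sinh_sq z
  unfold sech2
  rw [div_pow, one_pow, ← this]; ring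

lemma snapshot {b : ℝ} (hb : b ∈ Set.Ioo (0 : ℝ) 3)
    {u : ℝ → ℝ → ℝ} (hu : IsH2NonnegMomentumSolution b u) :
    ∃ M K : ℝ, 0 ≤ M ∧ ∀ t, 0 < t →
      (∫ x, u t x = M) ∧ (∀ x, |deriv (u t) x| ≤ u t x) ∧
      Integrable (flux b u t) ∧
      (∀ x, (u t x) ^ 2 / 2 ≤ flux b u t x) ∧
      (∀ x, HasDerivAt (flux b u t) (-(deriv (fun s => u s x) t)) x) ∧
      Integrable (fun x => deriv (fun s => u s x) t) ∧
      ∫ x, |deriv (fun s => u s x) t| ≤ K ∧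
      (∀ x, u t x ≤ M) := by
  obtain ⟨hct, hcx, hc0, hc1, hc2, hc3, hc4, hc5, heq, hint, hm, hcons⟩ := hu
  obtain ⟨hb0, hb3⟩ := hb
  set M := ∫ x, mom u 0 x with hM
  set E := ∫ x : ℝ, Real.exp (-|x|) with hE
  have hM0 : 0 ≤ M := integral_nonneg fun x => hm 0 x le_rfl
  have hE0 : 0 ≤ E := integral_nonneg fun x => (Real.exp_pos _).le
  refine ⟨M, M * M + (1/2) * (E * ((3/2) * M * M)), hM0, fun t ht => ?_⟩
  obtain ⟨i0, i0', i1, i1', i2, i2'⟩ := hint t ht.le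
  have d0 : ∀ x, HasDerivAt (u t) (deriv (u t) x) x := fun x =>
    ((hcx t).differentiable (by norm_num) x).hasDerivAt
  have d1 : ∀ x, HasDerivAt (deriv (u t)) (deriv (deriv (u t)) x) x := fun x => by
    have h3 : ContDiff ℝ (2 + 1) (u t) := by simpa [show (2:WithTop ℕ∞) + 1 = 3 by norm_num] using hcx t
    have : ContDiff ℝ 2 (deriv (u t)) := ((contDiff_succ_iff_deriv).1 h3).2.2
    exact (this.differentiable (by norm_num) x).hasDerivAt
  have hab := aux_abs_deriv_le d0 d1 i0 i1 i2 (fun x => hm t x ht.le)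
  have hn : ∀ x, 0 ≤ u t x := fun x => (abs_nonneg _).trans (hab x)
  have hIu : ∫ x, u t x = M := by
    have e := hcons t ht.le
    unfold mom at e
    rw [integral_sub i0 i2, integral_eq_zero_of_hasDerivAt_of_integrable d1 i2 i1, sub_zero] at e
    exact e
  have hle : ∀ x, u t x ≤ M := fun x => hIu ▸ aux_le_integral d0 i0 i1 hab x
  set f : ℝ → ℝ := fun z => (b / 2) * (u t z) ^ 2 + ((3 - b) / 2) * (deriv (u t) z) ^ 2 with hf
  have f0 : ∀ x, 0 ≤ f x := fun x => by
    have : 0 < 3 - b := by linarith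
    simp only [hf]; positivity
  have fle : ∀ x, f x ≤ (3/2) * M * u t x := fun x => by
    have h1 : (deriv (u t) x)^2 ≤ (u t x)^2 := by
      rw [← sq_abs]; exact pow_le_pow_left₀ (abs_nonneg _) (hab x) 2
    have h2 : (u t x)^2 ≤ M * u t x := by nlinarith [hn x, hle x]
    simp only [hf]
    nlinarith
  have cu : Continuous (u t) := (hcx t).continuous
  have cu' : Continuous (deriv (u t)) := continuous_iff_continuousAt.2 fun x => (d1 x).continuousAt
  have fi : Integrable f := (i0'.const_mul _).add (i1'.const_mul _)
  have fc : Continuous f := by simp only [hf]; fun_prop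
  obtain ⟨g, hg, hgb⟩ := aux_G_deriv fc fi f0
  obtain ⟨Gi, GI⟩ := aux_G_int fi
  have G0 : ∀ x, 0 ≤ G f x := fun x => (abs_nonneg _).trans (hgb x)
  have eF : flux b u t = fun y => (1/2) * (u t y)^2 + G f y := rfl
  have dF : ∀ x, HasDerivAt (flux b u t) (u t x * deriv (u t) x + g x) x := fun x => by
    rw [eF]
    refine (((d0 x).pow 2).const_mul (1/2)|>.add (hg x)).congr_deriv ?_
    simp; ring
  have eq : ∀ x, deriv (fun s => u s x) t = -(u t x * deriv (u t) x + g x) := fun x => by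
    have := heq t x ht
    rw [(dF x).deriv] at this; linarith
  have bd : ∀ x, |deriv (fun s => u s x) t| ≤ M * u t x + G f x := fun x => by
    rw [eq, abs_neg]
    refine (abs_add_le _ _).trans (add_le_add ?_ (hgb x))
    rw [abs_mul, abs_of_nonneg (hn x)]
    exact mul_le_mul (hle x) (hab x) (abs_nonneg _) hM0
  have ib : Integrable (fun x => M * u t x + G f x) := (i0.const_mul _).add Gi
  have ct : Continuous (fun x => deriv (fun s => u s x) t) :=
    hc1.comp (by fun_prop : Continuous fun x : ℝ => (t, x))
  have it : Integrable (fun x => deriv (fun s => u s x) t) :=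
    ib.mono' ct.aestronglyMeasurable (Eventually.of_forall bd)
  refine ⟨hIu, hab, ?_, ?_, ?_, it, ?_, hle⟩
  · rw [eF]; exact (i0'.const_mul _).add Gi
  · intro x; rw [eF]; have := G0 x; simp only; linarith
  · intro x; rw [eq, neg_neg]; exact dF x
  · refine (integral_mono it.abs ib bd).trans ?_
    rw [integral_add (i0.const_mul _) Gi, integral_const_mul, hIu, GI]
    have : ∫ x, f x ≤ (3/2) * M * M := by
      refine (integral_mono fi (i0.const_mul _) fle).trans ?_
      rw [integral_const_mul, hIu]
    gcongr

lemma hasDerivAt_scale {φ φ' : ℝ → ℝ} (dφ : ∀ z, HasDerivAt φ (φ' z) z) (μ x : ℝ) :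
    HasDerivAt (fun x => φ (μ * x)) (φ' (μ * x) * μ) x := by
  have h : HasDerivAt (fun x => μ * x) μ x := by simpa using (hasDerivAt_id x).const_mul μ
  exact (dφ (μ * x)).comp x h

/-- fixed-time lower bound -/
lemma fixed_time {v F vt φ φ' : ℝ → ℝ} {μ γ : ℝ} (hμ : 0 < μ)
    (cv : Continuous v) (iv : Integrable v) (v0 : ∀ x, 0 ≤ v x)
    (iF : Integrable F) (hF : ∀ x, (v x) ^ 2 / 2 ≤ F x)
    (dF : ∀ x, HasDerivAt F (-(vt x)) x) (it : Integrable vt)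
    (dφ : ∀ z, HasDerivAt φ (φ' z) z) (cφ' : Continuous φ') (bφ : ∀ z, |φ z| ≤ 7)
    (l : ∀ z, 4 * sech2 z ≤ φ' z) (r : ∀ z, φ' z ≤ 8 * sech2 z) :
    Integrable (fun x => φ (μ * x) * vt x + (φ' (μ * x) * (-(γ * μ) * x)) * v x) ∧
    (∫ x, |φ (μ * x) * vt x + (φ' (μ * x) * (-(γ * μ) * x)) * v x| ≤
      7 * (∫ x, |vt x|) + 8 * |γ| * ∫ x, v x) ∧
    -(8 * (γ ^ 2 / μ ^ 2) * ∫ z, z ^ 2 * sech2 z) ≤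
      ∫ x, (φ (μ * x) * vt x + (φ' (μ * x) * (-(γ * μ) * x)) * v x) := by
  have cφ : Continuous φ := continuous_iff_continuousAt.2 fun x => (dφ x).continuousAt
  have cF : Continuous F := continuous_iff_continuousAt.2 fun x => (dF x).continuousAt
  have F0 : ∀ x, 0 ≤ F x := fun x => le_trans (by positivity) (hF x)
  have p0 : ∀ z, 0 ≤ φ' z := fun z => le_trans (by have := sech2_pos z; positivity) (l z)
  have zb : ∀ x, |φ' (μ * x) * (-(γ * μ) * x)| ≤ 8 * |γ| := fun x => by
    have h1 := abs_mul_sech2 (μ * x)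
    have e : φ' (μ * x) * (-(γ * μ) * x) = -(γ * ((μ * x) * φ' (μ * x))) := by ring
    rw [e, abs_neg, abs_mul, abs_mul, abs_of_nonneg (p0 _)]
    have := mul_le_mul_of_nonneg_left (r (μ * x)) (abs_nonneg (μ * x))
    have h3 : |μ * x| * φ' (μ * x) ≤ 8 := by linarith
    nlinarith [abs_nonneg γ]
  have bd1 : ∀ x, |φ (μ * x) * vt x| ≤ 7 * |vt x| := fun x => by
    rw [abs_mul]; exact mul_le_mul_of_nonneg_right (bφ _) (abs_nonneg _)
  have bd2 : ∀ x, |(φ' (μ * x) * (-(γ * μ) * x)) * v x| ≤ 8 * |γ| * v x := fun x => by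
    rw [abs_mul, abs_of_nonneg (v0 x)]; exact mul_le_mul_of_nonneg_right (zb _) (v0 x)
  have I1 : Integrable (fun x => φ (μ * x) * vt x) :=
    (it.abs.const_mul 7).mono' ((by fun_prop : Continuous fun x => φ (μ * x)).aestronglyMeasurable.mul
      it.aestronglyMeasurable) (Eventually.of_forall bd1)
  have I2 : Integrable (fun x => (φ' (μ * x) * (-(γ * μ) * x)) * v x) :=
    (iv.const_mul _).mono' (by fun_prop) (Eventually.of_forall bd2)
  have p8 : ∀ z, φ' z ≤ 8 := fun z => (r z).trans (by linarith [sech2_le_one z])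
  have I3 : Integrable (fun x => (φ' (μ * x) * μ) * F x) := by
    refine (iF.const_mul (8 * μ)).mono' (by fun_prop) (Eventually.of_forall fun x => ?_)
    rw [Real.norm_eq_abs, abs_of_nonneg (mul_nonneg (mul_nonneg (p0 _) hμ.le) (F0 _))]
    exact mul_le_mul_of_nonneg_right (mul_le_mul_of_nonneg_right (p8 _) hμ.le) (F0 _)
  have I4 : Integrable (fun x => φ (μ * x) * F x) := by
    refine (iF.const_mul 7).mono' (by fun_prop) (Eventually.of_forall fun x => ?_)
    rw [Real.norm_eq_abs, abs_mul, abs_of_nonneg (F0 x)]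
    exact mul_le_mul_of_nonneg_right (bφ _) (F0 _)
  refine ⟨I1.add I2, ?_, ?_⟩
  · refine (integral_mono (I1.add I2).abs ((it.abs.const_mul 7).add (iv.const_mul (8 * |γ|)))
      (fun x => (abs_add_le _ _).trans (add_le_add (bd1 x) (bd2 x)))).trans_eq ?_
    rw [integral_add' (it.abs.const_mul 7) (iv.const_mul (8 * |γ|)), integral_const_mul, integral_const_mul]
  · have ibp : ∫ x, φ (μ * x) * vt x = ∫ x, (φ' (μ * x) * μ) * F x := by
      have := integral_mul_deriv_eq_deriv_mul_of_integrable (u := fun x => φ (μ * x))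
        (u' := fun x => φ' (μ * x) * μ) (v := F) (v' := fun x => -(vt x))
        (fun x _ => by
          exact hasDerivAt_scale dφ μ x) (fun x _ => dF x)
        (by
          have := I1.neg
          refine this.congr (Eventually.of_forall fun x => ?_)
          simp) I3 I4
      simp only [mul_neg, integral_neg, neg_inj] at this
      exact this
    rw [integral_add I1 I2, ibp, ← integral_add I3 I2]
    have J : Integrable (fun x => (μ * x) ^ 2 * sech2 (μ * x)) :=
      sq_mul_sech2_int.comp_mul_left' hμ.ne'
    have eJ : ∫ x, (μ * x) ^ 2 * sech2 (μ * x) = μ⁻¹ * ∫ z, z ^ 2 * sech2 z := by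
      have := Measure.integral_comp_mul_left (fun z => z ^ 2 * sech2 z) μ
      rw [this, abs_of_pos (inv_pos.2 hμ), smul_eq_mul]
    have e : -(8 * (γ ^ 2 / μ ^ 2) * ∫ z, z ^ 2 * sech2 z) =
        ∫ x, -(8 * (γ ^ 2 / μ)) * ((μ * x) ^ 2 * sech2 (μ * x)) := by
      rw [integral_const_mul, eJ]; field_simp
    rw [e]
    refine integral_mono (J.const_mul _) (I3.add I2) fun x => ?_
    simp only [Pi.add_apply]
    have hs := sech2_pos (μ * x)
    have hl := l (μ * x)
    have hr := r (μ * x)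
    set s := sech2 (μ * x)
    set p := φ' (μ * x)
    have a1 : 2 * μ * s * (v x) ^ 2 ≤ p * μ * F x := by
      calc 2 * μ * s * (v x) ^ 2 = (4 * s) * μ * ((v x) ^ 2 / 2) := by ring
        _ ≤ p * μ * F x := by
          have := hF x
          have := p0 (μ * x)
          gcongr
    have a2 : |γ * (μ * x) * v x| ≤ μ / 4 * (v x) ^ 2 + γ ^ 2 / μ * (μ * x) ^ 2 := by
      have e1 : μ / 4 * (v x) ^ 2 + γ ^ 2 / μ * (μ * x) ^ 2 - γ * (μ * x) * v x
          = μ * (v x / 2 - γ * x) ^ 2 := by field_simp; ring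
      have e2 : μ / 4 * (v x) ^ 2 + γ ^ 2 / μ * (μ * x) ^ 2 + γ * (μ * x) * v x
          = μ * (v x / 2 + γ * x) ^ 2 := by field_simp; ring
      have n1 : 0 ≤ μ * (v x / 2 - γ * x) ^ 2 := by positivity
      have n2 : 0 ≤ μ * (v x / 2 + γ * x) ^ 2 := by positivity
      rw [abs_le]; constructor <;> linarith
    have a3 : -(8 * s * (μ / 4 * (v x) ^ 2 + γ ^ 2 / μ * (μ * x) ^ 2)) ≤
        p * (-(γ * μ) * x) * v x := by
      have e3 : p * (-(γ * μ) * x) * v x = -(p * (γ * (μ * x) * v x)) := by ring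
      rw [e3]
      apply neg_le_neg
      calc p * (γ * (μ * x) * v x) ≤ p * |γ * (μ * x) * v x| :=
            mul_le_mul_of_nonneg_left (le_abs_self _) (p0 _)
        _ ≤ 8 * s * (μ / 4 * (v x) ^ 2 + γ ^ 2 / μ * (μ * x) ^ 2) := by
            gcongr
    linarith

noncomputable def muF (t : ℝ) : ℝ := Real.log t / t ^ (1 / 2 : ℝ)

noncomputable def gamF (t : ℝ) : ℝ := (1 / 2 - 1 / Real.log t) / t

lemma div_lam (x t : ℝ) : x / lam (1 / 2) t = muF t * x := by
  unfold lam muF; rw [div_div_eq_mul_div]; ring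

lemma muF_pos {t : ℝ} (ht : 1 < t) : 0 < muF t :=
  div_pos (Real.log_pos ht) (Real.rpow_pos_of_pos (by linarith) _)

lemma muF_deriv {t : ℝ} (ht : 1 < t) : HasDerivAt muF (-(gamF t * muF t)) t := by
  have t0 : 0 < t := by linarith
  have hl := Real.log_pos ht
  have hp : 0 < t ^ (1 / 2 : ℝ) := Real.rpow_pos_of_pos t0 _
  have h := (Real.hasDerivAt_log t0.ne').div
    (Real.hasDerivAt_rpow_const (p := (1/2 : ℝ)) (Or.inl t0.ne')) hp.ne'
  refine h.congr_deriv ?_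
  rw [Real.rpow_sub_one t0.ne']
  unfold gamF muF
  set q := t ^ (1 / 2 : ℝ)
  field_simp
  ring

lemma gamF_bd {t : ℝ} (ht : Real.exp 1 ≤ t) :
    |gamF t| ≤ 1 ∧ gamF t ^ 2 / muF t ^ 2 ≤ (1 / 4) * (1 / (t * Real.log t ^ 2)) := by
  have h1 : 1 < t := lt_of_lt_of_le (by simp) ht
  have t0 : 0 < t := by linarith
  have hl : 1 ≤ Real.log t := by rw [Real.le_log_iff_exp_le t0]; exact ht
  have hq : (t ^ (1 / 2 : ℝ)) ^ 2 = t := by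
    rw [← Real.sqrt_eq_rpow, Real.sq_sqrt t0.le]
  have hi : 1 / Real.log t ≤ 1 := by rw [div_le_one (by linarith)]; exact hl
  have hi0 : 0 < 1 / Real.log t := by positivity
  have ha : |1 / 2 - 1 / Real.log t| ≤ 1 / 2 := by rw [abs_le]; constructor <;> linarith
  constructor
  · unfold gamF
    rw [abs_div, abs_of_pos t0, div_le_one t0]; linarith
  · unfold gamF muF
    rw [div_pow, div_pow, hq]
    have : (1 / 2 - 1 / Real.log t) ^ 2 ≤ 1 / 4 := by
      rw [← sq_abs]; nlinarith [abs_nonneg (1 / 2 - 1 / Real.log t)]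
    calc _ = (1 / 2 - 1 / Real.log t) ^ 2 * (1 / (t * Real.log t ^ 2)) := by
          set a := (1 / 2 - 1 / Real.log t)
          field_simp
      _ ≤ _ := by gcongr

lemma muF_tendsto : Tendsto muF atTop (nhds 0) :=
  (isLittleO_log_rpow_atTop (by norm_num : (0:ℝ) < 1/2)).tendsto_div_nhds_zero

lemma virial {b : ℝ} (hb : b ∈ Set.Ioo (0 : ℝ) 3)
    {u : ℝ → ℝ → ℝ} (hu : IsH2NonnegMomentumSolution b u) {φ φ' : ℝ → ℝ}
    (dφ : ∀ z, HasDerivAt φ (φ' z) z) (cφ' : Continuous φ') (bφ : ∀ z, |φ z| ≤ 7)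
    (l : ∀ z, 4 * sech2 z ≤ φ' z) (r : ∀ z, φ' z ≤ 8 * sech2 z) {S T : ℝ}
    (hS : Real.exp 1 ≤ S) (hST : S ≤ T) :
    -(2 * (∫ z, z ^ 2 * sech2 z) * (1 / Real.log S - 1 / Real.log T)) ≤
    (∫ x, φ (muF T * x) * u T x) - ∫ x, φ (muF S * x) * u S x := by
  obtain ⟨M, K, hM, H⟩ := snapshot hb hu
  obtain ⟨hct, hcx, hc0, hc1, hc2, hc3, hc4, hc5, heq, hint, hm, hcons⟩ := hu
  have cφ : Continuous φ := continuous_iff_continuousAt.2 fun x => (dφ x).continuousAt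
  have gt1 : ∀ t, S ≤ t → 1 < t := fun t ht =>
    lt_of_lt_of_le (by simp : (1:ℝ) < Real.exp 1) (hS.trans ht)
  set C0 := ∫ z, z ^ 2 * sech2 z with hC0
  have C00 : 0 ≤ C0 := integral_nonneg fun z => mul_nonneg (sq_nonneg z) (sech2_pos z).le
  set D : ℝ → ℝ → ℝ := fun t x => φ (muF t * x) * deriv (fun s => u s x) t
    + (φ' (muF t * x) * (-(gamF t * muF t) * x)) * u t x with hD
  have Hf : ∀ t, S ≤ t → Integrable (D t) ∧ (∫ x, |D t x| ≤ 7 * K + 8 * M) ∧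
      -(2 * C0 * (1 / (t * Real.log t ^ 2))) ≤ ∫ x, D t x := by
    intro t ht
    have h1 := gt1 t ht
    obtain ⟨a1, a2, a3, a4, a5, a6, a7, a8⟩ := H t (by linarith)
    obtain ⟨b1, b2⟩ := gamF_bd (hS.trans ht)
    have hi := (hint t (by linarith)).1
    obtain ⟨c1, c2, c3⟩ := fixed_time (γ := gamF t) (muF_pos h1) (hcx t).continuous hi
      (fun x => (abs_nonneg _).trans (a2 x)) a3 a4 a5 a6 dφ cφ' bφ l r
    refine ⟨c1, c2.trans ?_, le_trans ?_ c3⟩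
    · rw [a1]; nlinarith
    · rw [← hC0]; nlinarith
  have mlog : Measurable Real.log := Real.measurable_log
  have mmu : Measurable muF := by unfold muF; fun_prop
  have mga : Measurable gamF := by unfold gamF; fun_prop
  have mD : Measurable (Function.uncurry D) := by
    have m0 := hc0.measurable
    have m1 := hc1.measurable
    have p1 := cφ.measurable
    have p2 := cφ'.measurable
    simp only [hD, Function.uncurry_def]
    refine ((p1.comp ((mmu.comp measurable_fst).mul measurable_snd)).mul m1).add
      (((p2.comp ((mmu.comp measurable_fst).mul measurable_snd)).mul
        ((((mga.comp measurable_fst).mul (mmu.comp measurable_fst)).neg).mul measurable_snd)).mul m0)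
  have iD : Integrable (Function.uncurry D) ((volume.restrict (Set.uIoc S T)).prod volume) := by
    rw [Set.uIoc_of_le hST]
    rw [integrable_prod_iff mD.aestronglyMeasurable]
    constructor
    · refine (ae_restrict_iff' measurableSet_Ioc).2 (Eventually.of_forall fun t ht => ?_)
      exact (Hf t ht.1.le).1
    · refine Integrable.mono' (g := fun _ => 7 * K + 8 * M) (integrable_const _)
        (mD.aestronglyMeasurable.norm.integral_prod_right') ?_
      refine (ae_restrict_iff' measurableSet_Ioc).2 (Eventually.of_forall fun t ht => ?_)
      rw [Real.norm_eq_abs, abs_of_nonneg (integral_nonneg fun x => norm_nonneg _)]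
      exact (Hf t ht.1.le).2.1
  have ftc : ∀ x, ∫ t in S..T, D t x = φ (muF T * x) * u T x - φ (muF S * x) * u S x := by
    intro x
    refine intervalIntegral.integral_eq_sub_of_hasDerivAt (f := fun t => φ (muF t * x) * u t x) ?_ ?_
    · intro t ht
      rw [Set.uIcc_of_le hST] at ht
      have h1 : HasDerivAt (fun t => muF t * x) (-(gamF t * muF t) * x) t :=
        (muF_deriv (gt1 t ht.1)).mul_const x
      have h2 : HasDerivAt (fun t => φ (muF t * x)) (φ' (muF t * x) * (-(gamF t * muF t) * x)) t :=
        (dφ (muF t * x)).comp t h1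
      have h3 : HasDerivAt (fun s => u s x) (deriv (fun s => u s x) t) t :=
        ((hct x).differentiable (by norm_num) t).hasDerivAt
      refine (h2.mul h3).congr_deriv ?_
      simp only [hD]; ring
    · apply ContinuousOn.intervalIntegrable
      rw [Set.uIcc_of_le hST]
      have c1 : ContinuousOn muF (Set.Icc S T) := fun t ht =>
        (muF_deriv (gt1 t ht.1)).continuousAt.continuousWithinAt
      have c2 : ContinuousOn gamF (Set.Icc S T) := by
        unfold gamF
        have hlog : ContinuousOn Real.log (Set.Icc S T) :=
          Real.continuousOn_log.mono fun t ht => by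
            have := gt1 t ht.1
            simp only [Set.mem_compl_iff, Set.mem_singleton_iff]; linarith
        refine ContinuousOn.div (continuousOn_const.sub (continuousOn_const.div hlog ?_)) continuousOn_id ?_
        · intro t ht; exact (Real.log_pos (gt1 t ht.1)).ne'
        · intro t ht; have := gt1 t ht.1; exact (by linarith : t ≠ 0)
      have c3 : Continuous (fun t => u t x) := (hct x).continuous
      have c4 : Continuous (fun t => deriv (fun s => u s x) t) :=
        hc1.comp (by fun_prop : Continuous fun t : ℝ => (t, x))
      have c5 : ContinuousOn (fun t => muF t * x) (Set.Icc S T) := c1.mul continuousOn_const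
      exact ((cφ.comp_continuousOn c5).mul c4.continuousOn).add
        (((cφ'.comp_continuousOn c5).mul (((c2.mul c1).neg).mul continuousOn_const)).mul c3.continuousOn)
  have Iw : ∀ t, S ≤ t → Integrable (fun x => φ (muF t * x) * u t x) := by
    intro t ht
    have h1 := gt1 t ht
    have hi := (hint t (by linarith)).1
    have := (hcx t).continuous
    refine (hi.abs.const_mul 7).mono' (by fun_prop) (Eventually.of_forall fun x => ?_)
    rw [Real.norm_eq_abs, abs_mul]; exact mul_le_mul_of_nonneg_right (bφ _) (abs_nonneg _)
  rw [← integral_sub (Iw T hST) (Iw S le_rfl)]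
  simp_rw [← ftc]
  rw [← intervalIntegral_integral_swap iD]
  have logd : ∀ t, S ≤ t → HasDerivAt (fun t => 2 * C0 * (1 / Real.log t))
      (-(2 * C0 * (1 / (t * Real.log t ^ 2)))) t := by
    intro t ht
    have h1 := gt1 t ht
    have hl := Real.log_pos h1
    have := ((Real.hasDerivAt_log (by linarith : t ≠ 0)).inv hl.ne').const_mul (2 * C0)
    have e : (fun t => 2 * C0 * (1 / Real.log t)) = fun t => 2 * C0 * (Real.log⁻¹) t := by
      funext t; simp
    rw [e]
    refine this.congr_deriv ?_
    field_simp
  have ie : IntervalIntegrable (fun t => -(2 * C0 * (1 / (t * Real.log t ^ 2)))) volume S T := by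
    apply ContinuousOn.intervalIntegrable
    rw [Set.uIcc_of_le hST]
    have hlog : ContinuousOn Real.log (Set.Icc S T) :=
          Real.continuousOn_log.mono fun t ht => by
            have := gt1 t ht.1
            simp only [Set.mem_compl_iff, Set.mem_singleton_iff]; linarith
    refine (continuousOn_const.mul (continuousOn_const.div (continuousOn_id.mul (hlog.pow 2)) ?_)).neg
    intro t ht
    have h1 := gt1 t ht.1
    have hl := Real.log_pos h1
    have : 0 < t := by linarith
    have hne : t * Real.log t ^ 2 ≠ 0 := by positivity
    exact hne
  have ee := intervalIntegral.integral_eq_sub_of_hasDerivAt (a := S) (b := T)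
    (fun t ht => by rw [Set.uIcc_of_le hST] at ht; exact logd t ht.1) ie
  have : -(2 * C0 * (1 / Real.log S - 1 / Real.log T)) =
    ∫ t in S..T, -(2 * C0 * (1 / (t * Real.log t ^ 2))) := by rw [ee]; ring
  rw [this]
  refine intervalIntegral.integral_mono_on hST ie ?_ fun t ht => (Hf t ht.1).2.2
  rw [intervalIntegrable_iff]
  exact iD.integral_prod_left

lemma weight_limit {b : ℝ} (hb : b ∈ Set.Ioo (0 : ℝ) 3)
    {u : ℝ → ℝ → ℝ} (hu : IsH2NonnegMomentumSolution b u) {φ φ' : ℝ → ℝ}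
    (dφ : ∀ z, HasDerivAt φ (φ' z) z) (cφ' : Continuous φ') (bφ : ∀ z, |φ z| ≤ 7)
    (l : ∀ z, 4 * sech2 z ≤ φ' z) (r : ∀ z, φ' z ≤ 8 * sech2 z) :
    ∃ L, Tendsto (fun t => ∫ x, φ (muF t * x) * u t x) atTop (nhds L) := by
  have V := @virial b hb u hu φ φ' dφ cφ' bφ l r
  obtain ⟨M, K, hM, H⟩ := snapshot hb hu
  have hint := hu.2.2.2.2.2.2.2.2.2.1
  set C0 := ∫ z, z ^ 2 * sech2 z with hC0
  have C00 : 0 ≤ C0 := integral_nonneg fun z => mul_nonneg (sq_nonneg z) (sech2_pos z).le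
  set W : ℝ → ℝ := fun t => (∫ x, φ (muF t * x) * u t x) - 2 * C0 * (1 / Real.log t) with hW
  set e1 := Real.exp 1
  have mono : Monotone (fun t => W (max e1 t)) := by
    intro s t hst
    have := V (le_max_left e1 s) (max_le_max le_rfl hst)
    simp only [hW]; linarith
  have bdd : BddAbove (Set.range fun t => W (max e1 t)) := by
    refine ⟨7 * M, ?_⟩
    rintro _ ⟨t, rfl⟩
    simp only [hW]
    set T := max e1 t
    have hT : 1 < T := lt_of_lt_of_le (by simp [e1]) (le_max_left e1 t)
    have hl := Real.log_pos hT
    obtain ⟨a1, a2, -⟩ := H T (by linarith)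
    have hi := (hint T (by linarith)).1
    have u0 : ∀ x, 0 ≤ u T x := fun x => (abs_nonneg _).trans (a2 x)
    have : ∫ x, φ (muF T * x) * u T x ≤ ∫ x, 7 * u T x := by
      have cφ : Continuous φ := continuous_iff_continuousAt.2 fun x => (dφ x).continuousAt
      have cu := (hu.2.1 T).continuous
      refine integral_mono (((hi.const_mul 7).mono' (by fun_prop) (Eventually.of_forall fun x => ?_)))
        (hi.const_mul 7) fun x => mul_le_mul_of_nonneg_right ((le_abs_self _).trans (bφ _)) (u0 x)
      rw [Real.norm_eq_abs, abs_mul, abs_of_nonneg (u0 x)]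
      exact mul_le_mul_of_nonneg_right (bφ _) (u0 x)
    rw [integral_const_mul, a1] at this
    have : 0 ≤ 2 * C0 * (1 / Real.log T) := by positivity
    linarith
  have lim := tendsto_atTop_ciSup mono bdd
  set L := ⨆ t, W (max e1 t)
  have limW : Tendsto W atTop (nhds L) := by
    refine lim.congr' ?_
    filter_upwards [eventually_ge_atTop e1] with t ht
    rw [max_eq_right ht]
  have llog : Tendsto (fun t => 2 * C0 * (1 / Real.log t)) atTop (nhds 0) := by
    have := (Real.tendsto_log_atTop.inv_tendsto_atTop).const_mul (2 * C0)
    simpa using this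
  refine ⟨L, ?_⟩
  have := limW.add llog
  simpa [hW] using this


lemma tanh_cont : Continuous Real.tanh :=
  continuous_iff_continuousAt.2 fun x => (hasDerivAt_tanh' x).continuousAt

/-- For a global classical `H²` solution with nonnegative momentum,
`lim_{t→∞} 𝓔(t)` exists and equals `lim_{t→∞} ∫ sech²(x/λ(t)) u(t,x) dx`. -/
theorem energy_functional_limit (b : ℝ) (hb : b ∈ Set.Ioo (0 : ℝ) 3)
    (u : ℝ → ℝ → ℝ) (hu : IsH2NonnegMomentumSolution b u) :
    ∃ L : ℝ, Filter.Tendsto (Efun u) Filter.atTop (nhds L) ∧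
      Filter.Tendsto (fun t : ℝ => ∫ x : ℝ, sech2 (x / lam (1 / 2) t) * u t x)
        Filter.atTop (nhds L) := by
  obtain ⟨L1, h1⟩ := weight_limit hb hu (φ := fun z => 6 * Real.tanh z + sech2 z)
    (φ' := fun z => 6 * sech2 z + (-2 * sech2 z * Real.tanh z))
    (fun z => ((hasDerivAt_tanh' z).const_mul 6).add (hasDerivAt_sech2 z))
    ((continuous_const.mul sech2_cont).add ((continuous_const.mul sech2_cont).mul tanh_cont))
    (fun z => by
      have := abs_lt.1 (Real.abs_tanh_lt_one z)
      have := sech2_pos z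
      have := sech2_le_one z
      rw [abs_le]; constructor <;> linarith)
    (fun z => by
      have := abs_lt.1 (Real.abs_tanh_lt_one z)
      have := sech2_pos z
      nlinarith)
    (fun z => by
      have := abs_lt.1 (Real.abs_tanh_lt_one z)
      have := sech2_pos z
      nlinarith)
  obtain ⟨L2, h2⟩ := weight_limit hb hu (φ := fun z => 6 * Real.tanh z - sech2 z)
    (φ' := fun z => 6 * sech2 z - (-2 * sech2 z * Real.tanh z))
    (fun z => ((hasDerivAt_tanh' z).const_mul 6).sub (hasDerivAt_sech2 z))
    ((continuous_const.mul sech2_cont).sub ((continuous_const.mul sech2_cont).mul tanh_cont))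
    (fun z => by
      have := abs_lt.1 (Real.abs_tanh_lt_one z)
      have := sech2_pos z
      have := sech2_le_one z
      rw [abs_le]; constructor <;> linarith)
    (fun z => by
      have := abs_lt.1 (Real.abs_tanh_lt_one z)
      have := sech2_pos z
      nlinarith)
    (fun z => by
      have := abs_lt.1 (Real.abs_tanh_lt_one z)
      have := sech2_pos z
      nlinarith)
  obtain ⟨M, K, hM, H⟩ := snapshot hb hu
  have hcx := hu.2.1
  have hint := hu.2.2.2.2.2.2.2.2.2.1
  have cs := sech2_cont
  have ct := tanh_cont
  have hB : Tendsto (fun t : ℝ => ∫ x : ℝ, sech2 (x / lam (1 / 2) t) * u t x)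
        Filter.atTop (nhds ((L1 - L2) / 2)) := by
    refine ((h1.sub h2).div_const 2).congr' ?_
    filter_upwards [eventually_ge_atTop 0] with t ht
    have hi := (hint t ht).1
    have cu := (hcx t).continuous
    simp_rw [div_lam]
    have bdd : ∀ w : ℝ → ℝ, Continuous w → (∀ z, |w z| ≤ 7) →
        Integrable (fun x => w (muF t * x) * u t x) := by
      intro w cw bw
      refine (hi.abs.const_mul 7).mono' (by fun_prop) (Eventually.of_forall fun x => ?_)
      rw [Real.norm_eq_abs, abs_mul]; exact mul_le_mul_of_nonneg_right (bw _) (abs_nonneg _)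
    have J1 := bdd (fun z => 6 * Real.tanh z + sech2 z) (by fun_prop) (fun z => by
      have := abs_lt.1 (Real.abs_tanh_lt_one z)
      have := sech2_pos z
      have := sech2_le_one z
      rw [abs_le]; constructor <;> linarith)
    have J2 := bdd (fun z => 6 * Real.tanh z - sech2 z) (by fun_prop) (fun z => by
      have := abs_lt.1 (Real.abs_tanh_lt_one z)
      have := sech2_pos z
      have := sech2_le_one z
      rw [abs_le]; constructor <;> linarith)
    rw [← integral_sub J1 J2, ← integral_div]
    congr 1; funext x; ring
  refine ⟨(L1 - L2) / 2, ?_, hB⟩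
  have hR : Tendsto (fun t : ℝ => ∫ x : ℝ, sech2 (muF t * x) * deriv (deriv (u t)) x)
      atTop (nhds 0) := by
    have lim : Tendsto (fun t => 2 * M * |muF t|) atTop (nhds 0) := by
      simpa using (muF_tendsto.abs).const_mul (2 * M)
    refine squeeze_zero_norm' ?_ lim
    filter_upwards [eventually_gt_atTop 0] with t ht
    obtain ⟨a1, a2, -⟩ := H t ht
    obtain ⟨i0, i0', i1, i1', i2, i2'⟩ := hint t ht.le
    have h3 : ContDiff ℝ (2 + 1) (u t) := by
      simpa [show (2:WithTop ℕ∞) + 1 = 3 by norm_num] using hcx t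
    have h3' : ContDiff ℝ 2 (deriv (u t)) := ((contDiff_succ_iff_deriv).1 h3).2.2
    have d1 : ∀ x, HasDerivAt (deriv (u t)) (deriv (deriv (u t)) x) x := fun x =>
      (h3'.differentiable (by norm_num) x).hasDerivAt
    have c1 : Continuous (deriv (u t)) := h3'.continuous
    have bp : ∀ x, |(-2 * sech2 (muF t * x) * Real.tanh (muF t * x)) * muF t * deriv (u t) x|
        ≤ 2 * |muF t| * u t x := by
      intro x
      rw [abs_mul, abs_mul]
      have e : |(-2 * sech2 (muF t * x) * Real.tanh (muF t * x))| ≤ 2 := by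
        rw [abs_mul, abs_mul, abs_of_pos (sech2_pos _)]
        have q1 := (Real.abs_tanh_lt_one (muF t * x)).le
        have q2 := sech2_pos (muF t * x)
        have q3 := sech2_le_one (muF t * x)
        norm_num
        nlinarith [abs_nonneg (Real.tanh (muF t * x))]
      have := a2 x
      gcongr
    have I1 : Integrable (fun x => sech2 (muF t * x) * deriv (deriv (u t)) x) := by
      refine i2.abs.mono' ((by fun_prop : Continuous fun x => sech2 (muF t * x)).aestronglyMeasurable.mul
        i2.aestronglyMeasurable) (Eventually.of_forall fun x => ?_)
      rw [Real.norm_eq_abs, abs_mul, abs_of_pos (sech2_pos _)]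
      exact mul_le_of_le_one_left (abs_nonneg _) (sech2_le_one _)
    have I2 : Integrable (fun x => (-2 * sech2 (muF t * x) * Real.tanh (muF t * x)) * muF t
        * deriv (u t) x) :=
      (i0.const_mul _).mono' (by fun_prop) (Eventually.of_forall bp)
    have I3 : Integrable (fun x => sech2 (muF t * x) * deriv (u t) x) := by
      refine i1.abs.mono' (by fun_prop) (Eventually.of_forall fun x => ?_)
      rw [Real.norm_eq_abs, abs_mul, abs_of_pos (sech2_pos _)]
      exact mul_le_of_le_one_left (abs_nonneg _) (sech2_le_one _)
    have ibp := integral_mul_deriv_eq_deriv_mul_of_integrable (u := fun x => sech2 (muF t * x))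
      (v := deriv (u t)) (fun x _ => hasDerivAt_scale hasDerivAt_sech2 (muF t) x)
      (fun x _ => d1 x) I1 I2 I3
    rw [ibp, norm_neg]
    refine (norm_integral_le_of_norm_le (i0.const_mul _) (Eventually.of_forall bp)).trans_eq ?_
    rw [integral_const_mul, a1]; ring
  have := hB.sub hR
  rw [sub_zero] at this
  refine this.congr' ?_
  filter_upwards [eventually_gt_atTop 0] with t ht
  obtain ⟨i0, i0', i1, i1', i2, i2'⟩ := hint t ht.le
  unfold Efun mom
  simp_rw [div_lam]
  have gi : ∀ w : ℝ → ℝ, Integrable w → Integrable (fun x => sech2 (muF t * x) * w x) := by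
    intro w iw
    refine iw.abs.mono' ((by fun_prop : Continuous fun x => sech2 (muF t * x)).aestronglyMeasurable.mul
        iw.aestronglyMeasurable) (Eventually.of_forall fun x => ?_)
    rw [Real.norm_eq_abs, abs_mul, abs_of_pos (sech2_pos _)]
    exact mul_le_of_le_one_left (abs_nonneg _) (sech2_le_one _)
  rw [← integral_sub (gi _ i0) (gi _ i2)]
  congr 1; funext x; ring
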